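/- arXiv:1807.10155 — 5 statements merged into one kernel-verified Lean document; each statement's English description precedes it below -/
import Mathlib

section
/- Let (X,T) be a weakly mixing M-system and let (Y,S) be a minimal topological dynamical system. Then the following are equivalent: (1) (X,T) and (Y,S) are disjoint; (2) for every nonempty open set U ⊆ X and every nonempty open set V ⊆ Y there is x ∈ U such that for every y ∈ V the set N_{T×S}((x,y), U×V) = {n ∈ ℤ₊ : T^n x ∈ U and S^n y ∈ V} is syndetic; (3) for every nonempty open set U ⊆ X and every nonempty open set V ⊆ Y there is a minimal point x ∈ U such that for every y ∈ V the set N_{T×S}((x,y), U×V) is syndetic. -/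
open Set Function Filter Topology

structure TDS where
  carrier : Type
  [ms : MetricSpace carrier]
  [cs : CompactSpace carrier]
  map : carrier → carrier
  cont : Continuous map
  surj : Function.Surjective map

attribute [instance] TDS.ms TDS.cs

def orbit {X : Type*} (T : X → X) (x : X) : Set X :=
  Set.range fun n : ℕ => T^[n] x

def IsMinimalSys {Y : Type*} [TopologicalSpace Y] (S : Y → Y) : Prop :=
  ∀ y : Y, Dense (orbit S y)

def IsTransitiveSys {X : Type*} [TopologicalSpace X] (T : X → X) : Prop :=
  ∀ U V : Set X, IsOpen U → IsOpen V → U.Nonempty → V.Nonempty →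
    {n : ℕ | (U ∩ T^[n] ⁻¹' V).Nonempty}.Infinite

def IsWeaklyMixingSys {X : Type*} [TopologicalSpace X] (T : X → X) : Prop :=
  IsTransitiveSys fun p : X × X => (T p.1, T p.2)

def IsJoining {X Y : Type*} [TopologicalSpace X] [TopologicalSpace Y]
    (T : X → X) (S : Y → Y) (J : Set (X × Y)) : Prop :=
  J.Nonempty ∧ IsClosed J ∧ (∀ p ∈ J, (T p.1, S p.2) ∈ J) ∧
    Prod.fst '' J = Set.univ ∧ Prod.snd '' J = Set.univ

def DisjointSys {X Y : Type*} [TopologicalSpace X] [TopologicalSpace Y]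
    (T : X → X) (S : Y → Y) : Prop :=
  ∀ J : Set (X × Y), IsJoining T S J → J = Set.univ

def Syndetic (A : Set ℕ) : Prop :=
  ∃ N : ℕ, ∀ i : ℕ, ∃ j ≤ N, i + j ∈ A

def Thick (A : Set ℕ) : Prop :=
  ∀ L : ℕ, ∃ n : ℕ, ∀ j ≤ L, n + j ∈ A

def IsMinimalPoint {X : Type*} [TopologicalSpace X] (T : X → X) (x : X) : Prop :=
  ∀ y ∈ closure (orbit T x), closure (orbit T x) ⊆ closure (orbit T y)

def Proximal {X : Type*} [MetricSpace X] (T : X → X) (x y : X) : Prop :=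
  ∃ u : ℕ → ℕ, Filter.Tendsto (fun i => dist (T^[u i] x) (T^[u i] y)) Filter.atTop (nhds 0)

def IsDistalPoint {X : Type*} [MetricSpace X] (T : X → X) (x : X) : Prop :=
  ∀ y ∈ closure (orbit T x), Proximal T x y → y = x

def DynSyndetic (B : Set ℕ) : Prop :=
  ∃ 𝒴 : TDS, IsMinimalSys 𝒴.map ∧
    ∃ (y : 𝒴.carrier) (V : Set 𝒴.carrier),
      IsOpen V ∧ y ∈ V ∧ {n : ℕ | 𝒴.map^[n] y ∈ V} ⊆ B

def CentralSet (S : Set ℕ) : Prop :=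
  ∃ 𝒵 : TDS, ∃ (z w : 𝒵.carrier) (W : Set 𝒵.carrier),
    IsMinimalPoint 𝒵.map w ∧ Proximal 𝒵.map z w ∧ IsOpen W ∧ w ∈ W ∧
    {n : ℕ | 𝒵.map^[n] z ∈ W} ⊆ S

def CStarSet (A : Set ℕ) : Prop :=
  ∀ S : Set ℕ, CentralSet S → (A ∩ S).Nonempty

theorem IsMinimalPoint.iterate {X : Type*} [TopologicalSpace X] {T : X → X} {x : X}
    (hx : IsMinimalPoint T x) (n : ℕ) : IsMinimalPoint T (T^[n] x) := by
  have hsub : closure (orbit T (T^[n] x)) ⊆ closure (orbit T x) := by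
    refine closure_mono ?_
    rintro _ ⟨m, rfl⟩
    exact ⟨m + n, iterate_add_apply T m n x⟩
  exact fun y hy => hsub.trans (hx y (hsub hy))

theorem closure_orbit_subset {X : Type*} [TopologicalSpace X] {T : X → X} {C : Set X}
    (hC : IsClosed C) (hT : MapsTo T C C) {x : X} (hx : x ∈ C) : closure (orbit T x) ⊆ C := by
  refine closure_minimal ?_ hC
  rintro _ ⟨n, rfl⟩
  exact hT.iterate n hx

theorem isClosed_forall_iterate_notMem {X Y : Type*} [TopologicalSpace X] [TopologicalSpace Y]
    {T : X → X} {S : Y → Y} (hT : Continuous T) (hS : Continuous S) {U : Set X} {V : Set Y}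
    (hU : IsOpen U) (hV : IsOpen V) :
    IsClosed {p : X × Y | ∀ n : ℕ, ¬ (T^[n] p.1 ∈ U ∧ S^[n] p.2 ∈ V)} := by
  rw [ofPred_forall]
  refine isClosed_iInter fun n => ?_
  rw [← isOpen_compl_iff]
  have : IsOpen (Prod.map T^[n] S^[n] ⁻¹' (U ×ˢ V)) :=
    (hU.prod hV).preimage ((hT.iterate n).prodMap (hS.iterate n))
  convert this using 1
  ext p
  simp

/-- If the times of visit to `U × V` are not syndetic, some point in the orbit closure never visits
`U × V`. -/
theorem exists_forall_iterate_notMem_of_not_syndetic {X Y : Type*} [MetricSpace X] [CompactSpace X]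
    [MetricSpace Y] [CompactSpace Y] {T : X → X} {S : Y → Y} (hT : Continuous T)
    (hS : Continuous S) {U : Set X} {V : Set Y} (hU : IsOpen U) (hV : IsOpen V) {x : X} {y : Y}
    (h : ¬ Syndetic {n : ℕ | T^[n] x ∈ U ∧ S^[n] y ∈ V}) :
    ∃ p : X × Y, p.1 ∈ closure (orbit T x) ∧ ∀ n : ℕ, ¬ (T^[n] p.1 ∈ U ∧ S^[n] p.2 ∈ V) := by
  simp only [Syndetic, not_exists, not_forall, not_and, mem_ofPred_eq] at h
  choose i hi using h
  obtain ⟨p, φ, hφ, hp⟩ := CompactSpace.tendsto_subseq fun N => (T^[i N] x, S^[i N] y)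
  refine ⟨p, ?_, fun n hn => ?_⟩
  · refine mem_closure_of_tendsto ((continuous_fst.tendsto p).comp hp) ?_
    exact Eventually.of_forall fun N => ⟨i (φ N), rfl⟩
  · have hlim := (((hT.iterate n).prodMap (hS.iterate n)).tendsto p).comp hp
    have hev := hlim.eventually ((hU.prod hV).mem_nhds (show _ ∈ U ×ˢ V from hn))
    obtain ⟨N, hN, hnN⟩ := (hev.and (hφ.tendsto_atTop.eventually_ge_atTop n)).exists
    have h1 : T^[n] (T^[i (φ N)] x) ∈ U := hN.1
    have h2 : S^[n] (S^[i (φ N)] y) ∈ V := hN.2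
    rw [← iterate_add_apply, add_comm] at h1 h2
    exact hi (φ N) n hnN h1 h2

theorem DisjointSys.exists_minimalPoint_syndetic {X Y : Type*} [MetricSpace X] [CompactSpace X]
    [MetricSpace Y] [CompactSpace Y] {T : X → X} {S : Y → Y} (hT : Continuous T)
    (hS : Continuous S) (hM : Dense {x : X | IsMinimalPoint T x}) (hSmin : IsMinimalSys S)
    (hd : DisjointSys T S) {U : Set X} (hU : IsOpen U) (hUne : U.Nonempty) {V : Set Y}
    (hV : IsOpen V) (hVne : V.Nonempty) :
    ∃ x ∈ U, IsMinimalPoint T x ∧ ∀ y ∈ V, Syndetic {n : ℕ | T^[n] x ∈ U ∧ S^[n] y ∈ V} := by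
  by_contra! hcon
  set J : Set (X × Y) := {p | ∀ n : ℕ, ¬ (T^[n] p.1 ∈ U ∧ S^[n] p.2 ∈ V)} with hJ
  have hJc : IsClosed J := isClosed_forall_iterate_notMem hT hS hU hV
  have hJi : ∀ p ∈ J, (T p.1, S p.2) ∈ J := fun p hp n => by
    simpa only [iterate_succ_apply] using hp (n + 1)
  have hc1 : IsClosed (Prod.fst '' J) := (hJc.isCompact.image continuous_fst).isClosed
  have hc2 : IsClosed (Prod.snd '' J) := (hJc.isCompact.image continuous_snd).isClosed
  have hi1 : MapsTo T (Prod.fst '' J) (Prod.fst '' J) := by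
    rintro _ ⟨p, hp, rfl⟩
    exact ⟨_, hJi p hp, rfl⟩
  have hi2 : MapsTo S (Prod.snd '' J) (Prod.snd '' J) := by
    rintro _ ⟨p, hp, rfl⟩
    exact ⟨_, hJi p hp, rfl⟩
  have hfst : Prod.fst '' J = univ := by
    refine hc1.closure_eq.symm.trans (hM.mono fun x hx => ?_).closure_eq
    by_cases hxU : ∃ n, T^[n] x ∈ U
    · obtain ⟨n, hn⟩ := hxU
      obtain ⟨y, -, hns⟩ := hcon _ hn (hx.iterate n)
      obtain ⟨p, hp, hpJ⟩ := exists_forall_iterate_notMem_of_not_syndetic hT hS hU hV hns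
      have hp' : p.1 ∈ closure (orbit T x) := by
        refine closure_mono ?_ hp
        rintro _ ⟨m, rfl⟩
        exact ⟨m + n, iterate_add_apply T m n x⟩
      exact closure_orbit_subset hc1 hi1 (mem_image_of_mem _ hpJ)
        (hx _ hp' (subset_closure ⟨0, rfl⟩))
    · obtain ⟨v, -⟩ := hVne
      exact ⟨(x, v), fun n hn => hxU ⟨n, hn.1⟩, rfl⟩
  obtain ⟨u, hu⟩ := hUne
  obtain ⟨v, hv⟩ := hVne
  obtain ⟨p, hp, -⟩ : u ∈ Prod.fst '' J := hfst ▸ mem_univ u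
  have hsnd : Prod.snd '' J = univ := univ_subset_iff.1 <|
    (hSmin p.2).closure_eq ▸ closure_orbit_subset hc2 hi2 (mem_image_of_mem _ hp)
  have huv : (u, v) ∈ J := hd J ⟨⟨p, hp⟩, hJc, hJi, hfst, hsnd⟩ ▸ mem_univ _
  exact huv 0 ⟨hu, hv⟩

/-- Furstenberg's intersection lemma. -/
theorem IsWeaklyMixingSys.exists_hitting_subset {X : Type*} [TopologicalSpace X] {T : X → X}
    (hT : Continuous T) (hwm : IsWeaklyMixingSys T) {A B C D : Set X} (hA : IsOpen A)
    (hB : IsOpen B) (hC : IsOpen C) (hD : IsOpen D) (hAn : A.Nonempty) (hBn : B.Nonempty)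
    (hCn : C.Nonempty) (hDn : D.Nonempty) :
    ∃ E F : Set X, IsOpen E ∧ IsOpen F ∧ E.Nonempty ∧ F.Nonempty ∧
      ∀ m, (E ∩ T^[m] ⁻¹' F).Nonempty →
        (A ∩ T^[m] ⁻¹' B).Nonempty ∧ (C ∩ T^[m] ⁻¹' D).Nonempty := by
  obtain ⟨n, p, hp, hpn⟩ :=
    (hwm (A ×ˢ B) (C ×ˢ D) (hA.prod hB) (hC.prod hD) (hAn.prod hBn) (hCn.prod hDn)).nonempty
  have hit : (fun p : X × X => (T p.1, T p.2))^[n] p = (T^[n] p.1, T^[n] p.2) :=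
    congrFun (Prod.map_iterate T T n) p
  rw [mem_preimage, hit] at hpn
  refine ⟨A ∩ T^[n] ⁻¹' C, B ∩ T^[n] ⁻¹' D, hA.inter (hC.preimage (hT.iterate n)),
    hB.inter (hD.preimage (hT.iterate n)), ⟨p.1, hp.1, hpn.1⟩, ⟨p.2, hp.2, hpn.2⟩, ?_⟩
  rintro m ⟨z, ⟨hzA, hzC⟩, hzB, hzD⟩
  refine ⟨⟨z, hzA, hzB⟩, T^[n] z, hzC, ?_⟩
  rw [mem_preimage, ← iterate_add_apply] at hzD ⊢
  rwa [add_comm]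

theorem IsWeaklyMixingSys.exists_hitting_subset_finset {X ι : Type*} [TopologicalSpace X]
    {T : X → X} (hT : Continuous T) (hwm : IsWeaklyMixingSys T) {A : Set X} (hA : IsOpen A)
    (hAn : A.Nonempty) {W : ι → Set X} (hW : ∀ i, IsOpen (W i)) (hWn : ∀ i, (W i).Nonempty)
    (s : Finset ι) :
    ∃ E F : Set X, IsOpen E ∧ IsOpen F ∧ E.Nonempty ∧ F.Nonempty ∧
      ∀ m, (E ∩ T^[m] ⁻¹' F).Nonempty → ∀ i ∈ s, (A ∩ T^[m] ⁻¹' W i).Nonempty := by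
  classical
  induction s using Finset.induction_on with
  | empty => exact ⟨A, A, hA, hA, hAn, hAn, by simp⟩
  | insert i s _ ih =>
    obtain ⟨E, F, hE, hF, hEn, hFn, h⟩ := ih
    obtain ⟨E', F', hE', hF', hEn', hFn', h'⟩ :=
      hwm.exists_hitting_subset hT hA (hW i) hE hF hAn (hWn i) hEn hFn
    refine ⟨E', F', hE', hF', hEn', hFn', fun m hm => ?_⟩
    rw [Finset.forall_mem_insert]
    exact ⟨(h' m hm).1, h m (h' m hm).2⟩

theorem IsWeaklyMixingSys.exists_common_hitting {X ι : Type*} [TopologicalSpace X] [Finite ι]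
    {T : X → X} (hT : Continuous T) (hwm : IsWeaklyMixingSys T) {A : Set X} (hA : IsOpen A)
    (hAn : A.Nonempty) {W : ι → Set X} (hW : ∀ i, IsOpen (W i)) (hWn : ∀ i, (W i).Nonempty) :
    ∃ m, ∀ i, (A ∩ T^[m] ⁻¹' W i).Nonempty := by
  cases nonempty_fintype ι
  obtain ⟨E, F, hE, hF, hEn, hFn, h⟩ :=
    hwm.exists_hitting_subset_finset hT hA hAn hW hWn Finset.univ
  obtain ⟨m, p, hp, hpm⟩ :=
    (hwm (E ×ˢ E) (F ×ˢ F) (hE.prod hE) (hF.prod hF) (hEn.prod hEn) (hFn.prod hFn)).nonempty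
  have hit : (fun p : X × X => (T p.1, T p.2))^[m] p = (T^[m] p.1, T^[m] p.2) :=
    congrFun (Prod.map_iterate T T m) p
  rw [mem_preimage, hit] at hpm
  exact ⟨m, fun i => h m ⟨p.1, hp.1, hpm.1⟩ i (Finset.mem_univ i)⟩

/-- In a weakly mixing system there is an open set of points whose orbits, for each shift `i < L`,
imitate the visits of `x` to `U` along some block of length `M`, delayed by `i`. -/
theorem IsWeaklyMixingSys.exists_open_shadowing {X : Type*} [TopologicalSpace X] {T : X → X}
    (hT : Continuous T) (hTs : Surjective T) (hwm : IsWeaklyMixingSys T) {U : Set X}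
    (hU : IsOpen U) (x : X) (M L : ℕ) :
    ∃ Q : Set X, IsOpen Q ∧ Q.Nonempty ∧ ∀ i < L, ∃ t, ∀ q ∈ Q, ∀ j ≤ M,
      T^[t + j] x ∈ U → T^[t + j + i] q ∈ U := by
  induction L with
  | zero => exact ⟨univ, isOpen_univ, ⟨x, mem_univ x⟩, by simp⟩
  | succ L ih =>
    obtain ⟨Q, hQ, hQn, h⟩ := ih
    let W : Set (Fin (M + 1)) → Set X := fun σ => {z | ∀ j ∈ σ, T^[j + L] z ∈ U}
    have hW : ∀ σ, IsOpen (W σ) := fun σ => by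
      have : W σ = ⋂ j ∈ σ, T^[(j : ℕ) + L] ⁻¹' U := by ext; simp [W]
      rw [this]
      exact σ.toFinite.isOpen_biInter fun j _ => hU.preimage (hT.iterate _)
    obtain ⟨t, ht⟩ := hwm.exists_common_hitting hT hQ hQn
      (ι := {σ : Set (Fin (M + 1)) // (W σ).Nonempty}) (W := fun σ => W σ)
      (fun σ => hW σ) (fun σ => σ.2)
    let σ : Set (Fin (M + 1)) := {j | T^[t + j] x ∈ U}
    have hσ : (W σ).Nonempty := by
      obtain ⟨w, hw⟩ := hTs.iterate L (T^[t] x)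
      refine ⟨w, fun j hj => ?_⟩
      rw [iterate_add_apply, hw, ← iterate_add_apply, add_comm]
      exact hj
    refine ⟨Q ∩ T^[t] ⁻¹' W σ, hQ.inter ((hW σ).preimage (hT.iterate t)), ht ⟨σ, hσ⟩, fun i hi => ?_⟩
    obtain hi | rfl := Nat.lt_succ_iff_lt_or_eq.1 hi
    · obtain ⟨t', ht'⟩ := h i hi
      exact ⟨t', fun q hq => ht' q hq.1⟩
    · refine ⟨t, fun q hq j hj hx => ?_⟩
      have := hq.2 ⟨j, Nat.lt_succ_of_le hj⟩ hx
      rw [← iterate_add_apply] at this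
      convert this using 2
      simp only
      ring

theorem IsMinimalSys.exists_bounded_hitting {Y : Type*} [TopologicalSpace Y] [CompactSpace Y]
    {S : Y → Y} (hS : Continuous S) (hmin : IsMinimalSys S) {V : Set Y} (hV : IsOpen V)
    (hVn : V.Nonempty) : ∃ L, ∀ y, ∃ i ≤ L, S^[i] y ∈ V := by
  obtain ⟨s, hs⟩ := isCompact_univ.elim_finite_subcover (fun i => S^[i] ⁻¹' V)
    (fun i => hV.preimage (hS.iterate i)) fun y _ => by
      obtain ⟨_, hv, i, rfl⟩ := (hmin y).inter_open_nonempty V hV hVn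
      exact mem_iUnion.2 ⟨i, hv⟩
  refine ⟨s.sup id, fun y => ?_⟩
  obtain ⟨i, hi, hy⟩ := mem_iUnion₂.1 (hs (mem_univ y))
  exact ⟨i, Finset.le_sup (f := id) hi, hy⟩

/-- If every point of `V` has syndetically many simultaneous visits, then the gaps can be bounded
uniformly after a bounded delay, at the cost of enlarging `V` to a closed set. -/
theorem exists_uniform_gap {X Y : Type*} [MetricSpace Y] [CompactSpace Y]
    {T : X → X} {S : Y → Y} (hS : Continuous S) (hmin : IsMinimalSys S) {U : Set X} {V C : Set Y}
    (hV : IsOpen V) (hVn : V.Nonempty) (hC : IsClosed C) (hVC : V ⊆ C) {x : X}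
    (h : ∀ y ∈ V, Syndetic {n : ℕ | T^[n] x ∈ U ∧ S^[n] y ∈ V}) :
    ∃ M L : ℕ, ∀ y, ∃ i < L, ∀ t, ∃ j ≤ M, T^[t + j] x ∈ U ∧ S^[t + j] (S^[i] y) ∈ C := by
  let E : ℕ → Set Y := fun M => {y | ∀ t, ∃ j ≤ M, T^[t + j] x ∈ U ∧ S^[t + j] y ∈ C}
  have hE : ∀ M, IsClosed (E M) := fun M => by
    have : E M = ⋂ t, ⋃ j ∈ Iic M, {y | T^[t + j] x ∈ U} ∩ S^[t + j] ⁻¹' C := by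
      ext y; simp [E, and_left_comm]
    rw [this]
    exact isClosed_iInter fun t => (finite_Iic M).isClosed_biUnion fun j _ =>
      isClosed_const.inter (hC.preimage (hS.iterate _))
  have hcov : ⋃ k : ℕ × ℕ, S^[k.1] ⁻¹' E k.2 = univ := by
    refine eq_univ_of_forall fun y => ?_
    obtain ⟨_, hv, i, rfl⟩ := (hmin y).inter_open_nonempty V hV hVn
    obtain ⟨M, hM⟩ := h _ hv
    refine mem_iUnion.2 ⟨(i, M), fun t => ?_⟩
    obtain ⟨j, hj, hj1, hj2⟩ := hM t
    exact ⟨j, hj, hj1, hVC hj2⟩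
  have : Nonempty Y := hVn.to_type
  obtain ⟨⟨k, M⟩, hO⟩ := nonempty_interior_of_iUnion_of_closed
    (fun k : ℕ × ℕ => (hE k.2).preimage (hS.iterate k.1)) hcov
  obtain ⟨L, hL⟩ := hmin.exists_bounded_hitting hS isOpen_interior hO
  refine ⟨M, k + L + 1, fun y => ?_⟩
  obtain ⟨i, hi, hy⟩ := hL y
  have hy' := interior_subset hy
  rw [mem_preimage, ← iterate_add_apply] at hy'
  exact ⟨k + i, by omega, hy'⟩

theorem IsWeaklyMixingSys.disjointSys_of_syndetic {X Y : Type*} [TopologicalSpace X]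
    [MetricSpace Y] [CompactSpace Y] {T : X → X} {S : Y → Y} (hT : Continuous T)
    (hTs : Surjective T) (hwm : IsWeaklyMixingSys T) (hS : Continuous S) (hmin : IsMinimalSys S)
    (h : ∀ U : Set X, IsOpen U → U.Nonempty → ∀ V : Set Y, IsOpen V → V.Nonempty →
      ∃ x ∈ U, ∀ y ∈ V, Syndetic {n : ℕ | T^[n] x ∈ U ∧ S^[n] y ∈ V}) :
    DisjointSys T S := by
  rintro J ⟨-, hJc, hJi, hJ1, -⟩
  refine hJc.closure_eq.symm.trans (dense_iff_inter_open.2 ?_).closure_eq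
  rintro O hO ⟨⟨a, b⟩, hab⟩
  obtain ⟨U, V, hU, hV, ha, hb, hUV⟩ := isOpen_prod_iff.1 hO a b hab
  obtain ⟨C, hCb, hC, hCV⟩ := exists_mem_nhds_isClosed_subset (hV.mem_nhds hb)
  have hVn : (interior C).Nonempty := ⟨b, mem_interior_iff_mem_nhds.2 hCb⟩
  obtain ⟨x, -, hx⟩ := h U hU ⟨a, ha⟩ (interior C) isOpen_interior hVn
  obtain ⟨M, L, hML⟩ :=
    exists_uniform_gap hS hmin isOpen_interior hVn hC interior_subset hx
  obtain ⟨Q, -, ⟨q, hq⟩, hQ⟩ := hwm.exists_open_shadowing hT hTs hU x M L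
  obtain ⟨⟨_, y⟩, hqy, rfl⟩ : q ∈ Prod.fst '' J := hJ1 ▸ mem_univ q
  obtain ⟨i, hi, hgap⟩ := hML y
  obtain ⟨t, ht⟩ := hQ i hi
  obtain ⟨j, hj, hjU, hjC⟩ := hgap t
  rw [← iterate_add_apply] at hjC
  refine ⟨(T^[t + j + i] _, S^[t + j + i] y), hUV ⟨ht _ hq j hj hjU, hCV hjC⟩, ?_⟩
  have hmaps : MapsTo (Prod.map T S) J J := hJi
  have := hmaps.iterate (t + j + i) hqy
  rwa [Prod.map_iterate] at this

theorem stmt_4 {X : Type} [MetricSpace X] [CompactSpace X] (T : X → X)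
    (hTc : Continuous T) (hTs : Function.Surjective T)
    (hTtr : IsTransitiveSys T) (hTwm : IsWeaklyMixingSys T)
    (hM : Dense {x : X | IsMinimalPoint T x})
    {Y : Type} [MetricSpace Y] [CompactSpace Y] (S : Y → Y)
    (hSc : Continuous S) (hSs : Function.Surjective S) (hSmin : IsMinimalSys S) :
    List.TFAE
      [ DisjointSys T S,
        ∀ U : Set X, IsOpen U → U.Nonempty →
          ∀ V : Set Y, IsOpen V → V.Nonempty →
            ∃ x ∈ U, ∀ y ∈ V, Syndetic {n : ℕ | T^[n] x ∈ U ∧ S^[n] y ∈ V},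
        ∀ U : Set X, IsOpen U → U.Nonempty →
          ∀ V : Set Y, IsOpen V → V.Nonempty →
            ∃ x ∈ U, IsMinimalPoint T x ∧
              ∀ y ∈ V, Syndetic {n : ℕ | T^[n] x ∈ U ∧ S^[n] y ∈ V} ] := by
  tfae_have 1 → 3 := fun hd U hU hUn V hV hVn =>
    hd.exists_minimalPoint_syndetic hTc hSc hM hSmin hU hUn hV hVn
  tfae_have 3 → 2 := fun h U hU hUn V hV hVn =>
    let ⟨x, hxU, _, hx⟩ := h U hU hUn V hV hVn
    ⟨x, hxU, hx⟩
  tfae_have 2 → 1 := hTwm.disjointSys_of_syndetic hTc hTs hSc hSmin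
  tfae_finish
end

section
/- A subset S of ℤ₊ is a central set if and only if S = A ∩ B for some thick set A ⊆ ℤ₊ and some dynamical syndetic set B ⊆ ℤ₊. -/
open Set Function Filter Topology

theorem mapsTo_closure_orbit {X : Type*} [TopologicalSpace X] {T : X → X} (hT : Continuous T)
    (x : X) : MapsTo T (closure (orbit T x)) (closure (orbit T x)) := by
  refine MapsTo.closure ?_ hT
  rintro _ ⟨n, rfl⟩
  exact ⟨n + 1, iterate_succ_apply' T n x⟩

theorem IsMinimalPoint.surjOn_closure_orbit {X : Type*} [TopologicalSpace X] [T2Space X]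
    [CompactSpace X] {T : X → X} (hT : Continuous T) {x : X} (hx : IsMinimalPoint T x) :
    SurjOn T (closure (orbit T x)) (closure (orbit T x)) := by
  have hTx : T x ∈ closure (orbit T x) := subset_closure ⟨1, rfl⟩
  refine (hx _ hTx).trans (closure_minimal ?_ (isClosed_closure.isCompact.image hT).isClosed)
  rintro _ ⟨n, rfl⟩
  exact ⟨T^[n] x, subset_closure ⟨n, rfl⟩, (Commute.iterate_self T n x).symm⟩

theorem IsMinimalPoint.isMinimalSys_restrict {X : Type*} [TopologicalSpace X]
    {T : X → X} (hT : Continuous T) {x : X} (hx : IsMinimalPoint T x) :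
    IsMinimalSys ((mapsTo_closure_orbit hT x).restrict T _ _) := by
  intro y
  rw [Subtype.dense_iff]
  refine (hx y y.2).trans (closure_mono ?_)
  rintro _ ⟨n, rfl⟩
  exact ⟨_, ⟨n, rfl⟩, MapsTo.coe_iterate_restrict _ _ n⟩

theorem Proximal.thick_dist_lt {X : Type*} [MetricSpace X] [CompactSpace X] {T : X → X}
    (hT : Continuous T) {x y : X} (h : Proximal T x y) {ε : ℝ} (hε : 0 < ε) :
    Thick {n | dist (T^[n] x) (T^[n] y) < ε} := by
  intro L
  obtain ⟨u, hu⟩ := h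
  have hclose : ∀ j, ∀ᶠ i in atTop, dist (T^[u i + j] x) (T^[u i + j] y) < ε := by
    intro j
    obtain ⟨δ, hδ, hj⟩ := Metric.uniformContinuous_iff.1
      (CompactSpace.uniformContinuous_of_continuous (hT.iterate j)) ε hε
    filter_upwards [hu.eventually (gt_mem_nhds hδ)] with i hi
    rw [add_comm, iterate_add_apply, iterate_add_apply]
    exact hj hi
  obtain ⟨i, hi⟩ := ((finite_Iic L).eventually_all.2 fun j _ => hclose j).exists
  exact ⟨u i, hi⟩

theorem IsMinimalSys.isMinimalPoint_prodMk {X Y : Type*} [TopologicalSpace X] [T1Space X]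
    [TopologicalSpace Y] {T : X → X} {S : Y → Y} (hS : IsMinimalSys S) {x : X} (hx : IsFixedPt T x)
    (y : Y) : IsMinimalPoint (Prod.map T S) (x, y) := by
  have horb : ∀ y', orbit (Prod.map T S) (x, y') = {x} ×ˢ orbit S y' := by
    intro y'
    ext ⟨a, b⟩
    simp [orbit, Prod.map_iterate, hx.iterate _ |>.eq, eq_comm]
  have hclosure : ∀ y', closure (orbit (Prod.map T S) (x, y')) = {x} ×ˢ univ := by
    intro y'
    rw [horb, closure_prod_eq, closure_singleton, (hS y').closure_eq]
  rintro ⟨x', y'⟩ h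
  rw [hclosure] at h ⊢
  obtain rfl : x' = x := h.1
  rw [hclosure]

/-- The one-sided shift on sequences. -/
def seqShift {α : Type*} (s : ℕ → α) : ℕ → α := fun n => s (n + 1)

theorem seqShift_iterate_apply {α : Type*} (s : ℕ → α) (k n : ℕ) :
    seqShift^[k] s n = s (n + k) := by
  induction k generalizing s with
  | zero => rfl
  | succ k ih => rw [iterate_succ_apply, ih]; exact congrArg s (by omega)

theorem continuous_seqShift {α : Type*} [TopologicalSpace α] :
    Continuous (seqShift : (ℕ → α) → ℕ → α) := by
  unfold seqShift
  fun_prop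

theorem seqShift_surjective {α : Type*} : Surjective (seqShift : (ℕ → α) → ℕ → α) :=
  fun s => ⟨fun n => s (n - 1), rfl⟩

theorem Thick.exists_tendsto_seqShift {A : Set ℕ} (hA : Thick A) {χ : ℕ → Bool}
    (hχ : ∀ n ∈ A, χ n = true) :
    ∃ u : ℕ → ℕ, Tendsto (fun i => seqShift^[u i] χ) atTop (𝓝 fun _ => true) := by
  choose u hu using hA
  refine ⟨u, tendsto_pi_nhds.2 fun n => tendsto_const_nhds.congr' ?_⟩
  filter_upwards [eventually_ge_atTop n] with i hi
  rw [seqShift_iterate_apply, add_comm]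
  exact (hχ _ (hu i n hi)).symm

theorem CentralSet.exists_thick_inter_dynSyndetic {S : Set ℕ} (hS : CentralSet S) :
    ∃ A B : Set ℕ, Thick A ∧ DynSyndetic B ∧ S = A ∩ B := by
  obtain ⟨Z, z, w, W, hw, hzw, hW, hwW, hsub⟩ := hS
  obtain ⟨ε, hε, hball⟩ := Metric.isOpen_iff.1 hW w hwW
  let A : Set ℕ := {n | dist (Z.map^[n] z) (Z.map^[n] w) < ε / 2}
  let B : Set ℕ := {n | Z.map^[n] w ∈ Metric.ball w (ε / 2)}
  have hAB : A ∩ B ⊆ S := fun n hn => hsub <| hball <| by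
    have h₁ : dist (Z.map^[n] z) (Z.map^[n] w) < ε / 2 := hn.1
    have h₂ : dist (Z.map^[n] w) w < ε / 2 := hn.2
    exact (dist_triangle _ _ _).trans_lt (by linarith)
  refine ⟨A ∪ S, B ∪ S, fun L => ?_, ?_, ?_⟩
  · obtain ⟨n, hn⟩ := hzw.thick_dist_lt Z.cont (half_pos hε) L
    exact ⟨n, fun j hj => Or.inl (hn j hj)⟩
  · have hmaps := mapsTo_closure_orbit Z.cont w
    let Y : TDS :=
      { carrier := closure (orbit Z.map w)
        cs := isCompact_iff_compactSpace.1 isClosed_closure.isCompact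
        map := hmaps.restrict Z.map _ _
        cont := Z.cont.restrict hmaps
        surj := (MapsTo.restrict_surjective_iff hmaps).2 (hw.surjOn_closure_orbit Z.cont) }
    refine ⟨Y, hw.isMinimalSys_restrict Z.cont, ⟨w, subset_closure ⟨0, rfl⟩⟩,
      Subtype.val ⁻¹' Metric.ball w (ε / 2), Metric.isOpen_ball.preimage continuous_subtype_val,
      Metric.mem_ball_self (half_pos hε), fun n hn => Or.inl ?_⟩
    have h := MapsTo.coe_iterate_restrict hmaps ⟨w, subset_closure ⟨0, rfl⟩⟩ n
    change Z.map^[n] w ∈ Metric.ball w (ε / 2)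
    rw [← h]
    exact hn
  · rw [← inter_union_distrib_right, union_eq_right.2 hAB]

theorem Thick.centralSet_inter {A B : Set ℕ} (hA : Thick A) (hB : DynSyndetic B) :
    CentralSet (A ∩ B) := by
  classical
  obtain ⟨Y, hY, y, V, hV, hyV, hsub⟩ := hB
  let _ : MetricSpace (ℕ → Bool) := TopologicalSpace.metrizableSpaceMetric (ℕ → Bool)
  let Z : TDS :=
    { carrier := (ℕ → Bool) × Y.carrier
      map := Prod.map seqShift Y.map
      cont := continuous_seqShift.prodMap Y.cont
      surj := seqShift_surjective.prodMap Y.surj }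
  have hfix : IsFixedPt seqShift (fun _ : ℕ => true) := rfl
  let χ : ℕ → Bool := fun n => decide (n ∈ A)
  refine ⟨Z, (χ, y), (fun _ => true, y), {p | p.1 0 = true} ∩ Prod.snd ⁻¹' V,
    hY.isMinimalPoint_prodMk hfix y, ?_, ?_, ⟨rfl, hyV⟩, ?_⟩
  · obtain ⟨u, hu⟩ := hA.exists_tendsto_seqShift (χ := χ) (by simp [χ])
    refine ⟨u, (tendsto_iff_dist_tendsto_zero.1 hu).congr fun i => ?_⟩
    simp only [Z, Prod.map_iterate, Prod.map_apply, Prod.dist_eq, dist_self,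
      (hfix.iterate (u i)).eq]
    exact (max_eq_left dist_nonneg).symm
  · have h : Continuous fun p : Z.carrier => p.1 0 :=
      (continuous_apply 0).comp continuous_fst
    exact ((isOpen_discrete {true}).preimage h).inter (hV.preimage continuous_snd)
  · rintro n ⟨h₁, h₂⟩
    simp only [Z, Prod.map_iterate, Prod.map_apply, mem_ofPred_eq, mem_preimage] at h₁ h₂
    rw [seqShift_iterate_apply, zero_add] at h₁
    exact ⟨of_decide_eq_true h₁, hsub h₂⟩

theorem stmt_5 (S : Set ℕ) :
    CentralSet S ↔ ∃ A B : Set ℕ, Thick A ∧ DynSyndetic B ∧ S = A ∩ B := by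
  refine ⟨CentralSet.exists_thick_inter_dynSyndetic, ?_⟩
  rintro ⟨A, B, hA, hB, rfl⟩
  exact hA.centralSet_inter hB
end

section
/- Let (X,T) be a weakly mixing topological dynamical system with dense distal sets, i.e. for every nonempty open set U ⊆ X there is a nonempty closed set C ⊆ U that is a distal point of the induced hyperspace system (K(X), T_K). Then (X,T) is disjoint from every minimal topological dynamical system. -/
open Set Function Filter Topology

noncomputable def hyperMap {X : Type*} [MetricSpace X] (T : X → X) (hc : Continuous T) :
    TopologicalSpace.NonemptyCompacts X → TopologicalSpace.NonemptyCompacts X :=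
  fun A => ⟨⟨T '' (A : Set X), A.isCompact.image hc⟩, A.nonempty.image T⟩

attribute [local instance] Ultrafilter.add Ultrafilter.addSemigroup

section LimitAction

variable {Z : Type*} [TopologicalSpace Z] [T2Space Z] [CompactSpace Z]

/-- The limit of the orbit of `z` under `R` along an ultrafilter on `ℕ`. -/
noncomputable def orbitLim (R : Z → Z) (p : Ultrafilter ℕ) (z : Z) : Z :=
  Ultrafilter.extend (fun n => R^[n] z) p

theorem tendsto_orbitLim (R : Z → Z) (p : Ultrafilter ℕ) (z : Z) :
    Tendsto (fun n => R^[n] z) p (𝓝 (orbitLim R p z)) :=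
  ultrafilter_extend_eq_iff.1 rfl

theorem orbitLim_eq_of_tendsto {R : Z → Z} {p : Ultrafilter ℕ} {z w : Z}
    (h : Tendsto (fun n => R^[n] z) p (𝓝 w)) : orbitLim R p z = w :=
  ultrafilter_extend_eq_iff.2 h

theorem continuous_orbitLim (R : Z → Z) (z : Z) : Continuous fun p => orbitLim R p z :=
  continuous_ultrafilter_extend _

theorem orbitLim_add {R : Z → Z} (hR : Continuous R) (p q : Ultrafilter ℕ) (z : Z) :
    orbitLim R (p + q) z = orbitLim R p (orbitLim R q z) := by
  by_contra hne
  obtain ⟨O, O', hO, hO', h, h', hd⟩ := t2_separation hne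
  have h1 : ∀ᶠ n in (p + q : Ultrafilter ℕ), R^[n] z ∈ O :=
    tendsto_orbitLim R (p + q) z (hO.mem_nhds h)
  rw [Ultrafilter.eventually_add] at h1
  have h2 : ∀ᶠ i in p, R^[i] (orbitLim R q z) ∈ O' :=
    tendsto_orbitLim R p _ (hO'.mem_nhds h')
  obtain ⟨i, hi, hi'⟩ := (h1.and h2).exists
  have h3 : ∀ᶠ j in q, R^[i] (R^[j] z) ∈ O' :=
    (((hR.iterate i).tendsto _).comp (tendsto_orbitLim R q z)) (hO'.mem_nhds hi')
  obtain ⟨j, hj, hj'⟩ := (hi.and h3).exists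
  rw [Function.iterate_add_apply] at hj
  exact hd.le_bot ⟨hj, hj'⟩

theorem orbitLim_mem_closure_orbit (R : Z → Z) (p : Ultrafilter ℕ) (z : Z) :
    orbitLim R p z ∈ closure (orbit R z) :=
  mem_closure_of_tendsto (tendsto_orbitLim R p z) (Eventually.of_forall fun n => ⟨n, rfl⟩)

theorem exists_orbitLim_eq_of_mem_closure {R : Z → Z} {z w : Z}
    (h : w ∈ closure (orbit R z)) : ∃ p, orbitLim R p z = w := by
  have hcl : IsClosed (range fun p => orbitLim R p z) :=
    (isCompact_range (continuous_orbitLim R z)).isClosed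
  refine closure_minimal ?_ hcl h
  rintro _ ⟨n, rfl⟩
  exact ⟨pure n, ultrafilter_extend_pure _ n⟩

end LimitAction

section Metric

theorem proximal_of_forall_exists_dist_lt {Z : Type*} [MetricSpace Z] {R : Z → Z} {x y : Z}
    (h : ∀ ε > 0, ∃ n : ℕ, dist (R^[n] x) (R^[n] y) < ε) : Proximal R x y := by
  choose u hu using fun i : ℕ => h (1 / (i + 1)) Nat.one_div_pos_of_nat
  exact ⟨u, squeeze_zero (fun _ => dist_nonneg) (fun i => (hu i).le)
    tendsto_one_div_add_atTop_nhds_zero_nat⟩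

variable {Z : Type*} [MetricSpace Z] [CompactSpace Z]

theorem Proximal.exists_orbitLim_eq {R : Z → Z} {x y : Z} (h : Proximal R x y) :
    ∃ p, orbitLim R p x = orbitLim R p y := by
  obtain ⟨u, hu⟩ := h
  refine ⟨(Filter.hyperfilter ℕ).map u, ?_⟩
  set p := (Filter.hyperfilter ℕ).map u with hp
  have h0 : Tendsto (fun n => dist (R^[n] x) (R^[n] y)) p (𝓝 0) := by
    rw [hp, Ultrafilter.coe_map, tendsto_map'_iff]
    exact hu.mono_left (by simpa [Nat.cofinite_eq_atTop] using hyperfilter_le_cofinite (α := ℕ))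
  exact dist_eq_zero.1 <|
    tendsto_nhds_unique ((tendsto_orbitLim R p x).dist (tendsto_orbitLim R p y)) h0

theorem proximal_of_orbitLim_eq {R : Z → Z} {p : Ultrafilter ℕ} {x y : Z}
    (h : orbitLim R p x = orbitLim R p y) : Proximal R x y := by
  refine proximal_of_forall_exists_dist_lt fun ε hε => ?_
  have h0 := (tendsto_orbitLim R p x).dist (tendsto_orbitLim R p y)
  rw [h, dist_self] at h0
  exact (h0.eventually_lt_const hε).exists

theorem IsDistalPoint.orbitLim_eq_self {R : Z → Z} (hR : Continuous R) {x : Z}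
    (hx : IsDistalPoint R x) {p : Ultrafilter ℕ} (hp : p + p = p) : orbitLim R p x = x := by
  refine hx _ (orbitLim_mem_closure_orbit R p x) (proximal_of_orbitLim_eq (p := p) ?_)
  rw [← orbitLim_add hR, hp]

theorem Proximal.iterate {R : Z → Z} (hR : Continuous R) {x y : Z} (h : Proximal R x y) (n : ℕ) :
    Proximal R (R^[n] x) (R^[n] y) := by
  obtain ⟨p, hp⟩ := h.exists_orbitLim_eq
  have key : ∀ z, orbitLim R p (R^[n] z) = R^[n] (orbitLim R p z) := fun z => by
    refine orbitLim_eq_of_tendsto ?_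
    have := ((hR.iterate n).tendsto _).comp (tendsto_orbitLim R p z)
    refine this.congr fun m => ?_
    simp only [Function.comp_apply, ← Function.iterate_add_apply, add_comm]
  exact proximal_of_orbitLim_eq (p := p) (by rw [key, key, hp])

end Metric

theorem continuous_hyperMap {X : Type*} [MetricSpace X] {T : X → X} (hT : Continuous T) :
    Continuous (hyperMap T hT) :=
  hT.nonemptyCompacts_map

theorem coe_iterate_hyperMap {X : Type*} [MetricSpace X] {T : X → X} (hT : Continuous T)
    (C : TopologicalSpace.NonemptyCompacts X) (n : ℕ) :
    ((hyperMap T hT)^[n] C : Set X) = T^[n] '' (C : Set X) := by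
  induction n with
  | zero => simp
  | succ n ih =>
    rw [Function.iterate_succ_apply', Function.iterate_succ', image_comp, ← ih]
    rfl

theorem mem_of_tendsto_nonemptyCompacts {X ι : Type*} [TopologicalSpace X] [T2Space X]
    {l : Filter ι} [l.NeBot] {a : ι → X} {A : ι → TopologicalSpace.NonemptyCompacts X} {x : X}
    {D : TopologicalSpace.NonemptyCompacts X} (ha : Tendsto a l (𝓝 x)) (hA : Tendsto A l (𝓝 D))
    (h : ∀ i, a i ∈ A i) : x ∈ D := by
  by_contra hx
  obtain ⟨O, O', hO, hO', hxO, hDO', hd⟩ := SeparatedNhds.of_isCompact_isCompact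
    isCompact_singleton D.isCompact (disjoint_singleton_left.2 hx)
  have h1 : ∀ᶠ i in l, a i ∈ O := ha (hO.mem_nhds (hxO rfl))
  have h2 : ∀ᶠ i in l, (A i : Set X) ⊆ O' :=
    hA ((TopologicalSpace.NonemptyCompacts.isOpen_subsets_of_isOpen hO').mem_nhds hDO')
  obtain ⟨i, hi, hi'⟩ := (h1.and h2).exists
  exact disjoint_left.1 hd hi (hi' (h i))

theorem orbitLim_mem_orbitLim_hyperMap {X : Type*} [MetricSpace X] [CompactSpace X] {T : X → X}
    (hT : Continuous T) (p : Ultrafilter ℕ) {x : X} {C : TopologicalSpace.NonemptyCompacts X}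
    (hx : x ∈ C) : orbitLim T p x ∈ orbitLim (hyperMap T hT) p C := by
  refine mem_of_tendsto_nonemptyCompacts (tendsto_orbitLim T p x)
    (tendsto_orbitLim (hyperMap T hT) p C) fun n => ?_
  rw [← SetLike.mem_coe, coe_iterate_hyperMap]
  exact mem_image_of_mem _ hx

section WeakMixing

variable {X : Type*}

theorem iterate_prodMap_self (T : X → X) (n : ℕ) (p : X × X) :
    (fun p : X × X => (T p.1, T p.2))^[n] p = (T^[n] p.1, T^[n] p.2) := by
  induction n with
  | zero => rfl
  | succ n ih => simp only [Function.iterate_succ_apply', ih]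

theorem IsWeaklyMixingSys.exists_iterate_inter [TopologicalSpace X] {T : X → X}
    (hT : IsWeaklyMixingSys T) {U V U' V' : Set X} (hU : IsOpen U) (hV : IsOpen V)
    (hU' : IsOpen U') (hV' : IsOpen V') (nU : U.Nonempty) (nV : V.Nonempty) (nU' : U'.Nonempty)
    (nV' : V'.Nonempty) :
    ∃ n : ℕ, (U ∩ T^[n] ⁻¹' V).Nonempty ∧ (U' ∩ T^[n] ⁻¹' V').Nonempty := by
  obtain ⟨n, ⟨a, b⟩, ⟨ha, hb⟩, hab⟩ := (hT (U ×ˢ U') (V ×ˢ V') (hU.prod hU') (hV.prod hV')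
    (nU.prod nU') (nV.prod nV')).nonempty
  rw [mem_preimage, iterate_prodMap_self] at hab
  exact ⟨n, ⟨a, ha, hab.1⟩, ⟨b, hb, hab.2⟩⟩

/-- Furstenberg's intersection lemma: hitting-time sets of a weakly mixing system form
a filter base. -/
theorem IsWeaklyMixingSys.exists_forall_hitting [TopologicalSpace X] {T : X → X}
    (hT : IsWeaklyMixingSys T) (hc : Continuous T) {W : Set X} (hW : IsOpen W)
    (nW : W.Nonempty) (t : Finset (Set X)) (ht : ∀ B ∈ t, IsOpen B ∧ B.Nonempty) :
    ∃ U V : Set X, IsOpen U ∧ IsOpen V ∧ U.Nonempty ∧ V.Nonempty ∧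
      ∀ n : ℕ, (U ∩ T^[n] ⁻¹' V).Nonempty → ∀ B ∈ t, (W ∩ T^[n] ⁻¹' B).Nonempty := by
  classical
  induction t using Finset.induction_on with
  | empty => exact ⟨W, W, hW, hW, nW, nW, by simp⟩
  | insert B t _ ih =>
    obtain ⟨U, V, hU, hV, nU, nV, h⟩ := ih fun B hB => ht B (Finset.mem_insert_of_mem hB)
    obtain ⟨hB, nB⟩ := ht B (Finset.mem_insert_self B t)
    obtain ⟨n, n1, n2⟩ := hT.exists_iterate_inter hU hW hV hB nU nW nV nB
    refine ⟨U ∩ T^[n] ⁻¹' W, V ∩ T^[n] ⁻¹' B, hU.inter (hW.preimage (hc.iterate n)),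
      hV.inter (hB.preimage (hc.iterate n)), n1, n2, ?_⟩
    rintro m ⟨a, ⟨haU, haW⟩, haV, haB⟩ B' hB'
    rcases Finset.mem_insert.1 hB' with rfl | hB'
    · refine ⟨T^[n] a, haW, ?_⟩
      rw [mem_preimage, ← Function.iterate_add_apply, add_comm, Function.iterate_add_apply]
      exact haB
    · exact h m ⟨a, haU, haV⟩ B' hB'

theorem IsWeaklyMixingSys.dense_setOf_dist_iterate_lt [MetricSpace X] [CompactSpace X]
    {T : X → X} (hT : IsWeaklyMixingSys T) (hc : Continuous T) (c : X) {ε : ℝ} (hε : 0 < ε) :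
    Dense {x | ∃ n : ℕ, dist (T^[n] x) (T^[n] c) < ε} := by
  classical
  rw [dense_iff_inter_open]
  intro W hW nW
  obtain ⟨s, -, hs, hcov⟩ := finite_cover_balls_of_compact (isCompact_univ (X := X)) (half_pos hε)
  obtain ⟨U, V, hU, hV, nU, nV, h⟩ := hT.exists_forall_hitting hc hW nW
    (hs.toFinset.image fun z => Metric.ball z (ε / 2)) (by
      simp only [Finset.mem_image, forall_exists_index, and_imp]
      rintro _ z - rfl
      exact ⟨Metric.isOpen_ball, Metric.nonempty_ball.2 (half_pos hε)⟩)
  obtain ⟨n, hn, -⟩ := hT.exists_iterate_inter hU hV hU hV nU nV nU nV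
  obtain ⟨z, hz, hcz⟩ := mem_iUnion₂.1 (hcov (mem_univ (T^[n] c)))
  obtain ⟨x, hxW, hx⟩ := h n hn (Metric.ball z (ε / 2))
    (Finset.mem_image_of_mem _ (hs.mem_toFinset.2 hz))
  refine ⟨x, hxW, n, ?_⟩
  have h1 : dist (T^[n] x) z < ε / 2 := hx
  have h2 : dist (T^[n] c) z < ε / 2 := hcz
  linarith [dist_triangle_right (T^[n] x) (T^[n] c) z]

theorem IsWeaklyMixingSys.exists_forall_proximal [MetricSpace X] [CompactSpace X] [Nonempty X]
    {T : X → X} (hT : IsWeaklyMixingSys T) (hc : Continuous T) (c : ℕ → X) :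
    ∃ x, ∀ n, Proximal T x (c n) := by
  have hd : Dense (⋂ q : ℕ × ℕ,
      {x | ∃ n : ℕ, dist (T^[n] x) (T^[n] (c q.1)) < 1 / ((q.2 : ℝ) + 1)}) := by
    refine dense_iInter_of_isOpen (fun q => ?_) fun q =>
      hT.dense_setOf_dist_iterate_lt hc _ Nat.one_div_pos_of_nat
    simp only [ofPred_exists]
    exact isOpen_iUnion fun n => isOpen_lt ((hc.iterate n).dist continuous_const) continuous_const
  obtain ⟨x, hx⟩ := hd.nonempty
  refine ⟨x, fun i => proximal_of_forall_exists_dist_lt fun ε hε => ?_⟩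
  obtain ⟨k, hk⟩ := exists_nat_one_div_lt hε
  obtain ⟨n, hn⟩ := mem_iInter.1 hx (i, k)
  exact ⟨n, hn.trans hk⟩

end WeakMixing

/-- If `x` is proximal to `c` and `S` is minimal, then for every `y` some idempotent
ultrafilter fixes `y` and identifies `x` with `c`. -/
theorem Proximal.exists_idempotent {X Y : Type*} [MetricSpace X] [CompactSpace X] [MetricSpace Y]
    [CompactSpace Y] {T : X → X} {S : Y → Y} (hT : Continuous T) (hS : Continuous S)
    (hmin : IsMinimalSys S) {x c : X} (h : Proximal T x c) (y : Y) :
    ∃ p : Ultrafilter ℕ, p + p = p ∧ orbitLim S p y = y ∧ orbitLim T p x = orbitLim T p c := by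
  obtain ⟨q, hq⟩ := h.exists_orbitLim_eq
  obtain ⟨r, hr⟩ := exists_orbitLim_eq_of_mem_closure (hmin (orbitLim S q y) y)
  obtain ⟨p, ⟨hp1, hp2⟩, hp⟩ := exists_idempotent_in_compact_add_subsemigroup
    (M := Ultrafilter ℕ) Ultrafilter.continuous_add_left
    {p | orbitLim S p y = y ∧ orbitLim T p x = orbitLim T p c}
    ⟨r + q, by rw [orbitLim_add hS, hr], by rw [orbitLim_add hT, orbitLim_add hT, hq]⟩
    (IsClosed.isCompact ((isClosed_eq (continuous_orbitLim S y) continuous_const).inter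
      (isClosed_eq (continuous_orbitLim T x) (continuous_orbitLim T c))))
    (fun p hp q hq => ⟨by rw [orbitLim_add hS, hq.1, hp.1],
      by rw [orbitLim_add hT, orbitLim_add hT, hq.2]⟩)
  exact ⟨p, hp, hp1, hp2⟩

theorem IsJoining.iterate_mem {X Y : Type*} [TopologicalSpace X] [TopologicalSpace Y]
    {T : X → X} {S : Y → Y} {J : Set (X × Y)} (hJ : IsJoining T S J) {x : X} {y : Y}
    (h : (x, y) ∈ J) (n : ℕ) : (T^[n] x, S^[n] y) ∈ J := by
  induction n with
  | zero => exact h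
  | succ n ih =>
    rw [Function.iterate_succ_apply', Function.iterate_succ_apply']
    exact hJ.2.2.1 _ ih

theorem IsJoining.orbitLim_mem {X Y : Type*} [TopologicalSpace X] [T2Space X] [CompactSpace X]
    [TopologicalSpace Y] [T2Space Y] [CompactSpace Y]
    {T : X → X} {S : Y → Y} {J : Set (X × Y)} (hJ : IsJoining T S J) {x : X} {y : Y}
    (h : (x, y) ∈ J) (p : Ultrafilter ℕ) : (orbitLim T p x, orbitLim S p y) ∈ J :=
  hJ.2.1.mem_of_tendsto ((tendsto_orbitLim T p x).prodMk_nhds (tendsto_orbitLim S p y))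
    (Eventually.of_forall fun n => hJ.iterate_mem h n)

/-- A joining of a weakly mixing system with a minimal one meets `C × V` whenever `C` is a distal
point of the hyperspace and `V` is open and nonempty. -/
theorem IsJoining.inter_prod_nonempty_of_isDistalPoint {X Y : Type*} [MetricSpace X]
    [CompactSpace X] [MetricSpace Y] [CompactSpace Y] {T : X → X} {S : Y → Y} (hT : Continuous T)
    (hTs : Function.Surjective T) (hTwm : IsWeaklyMixingSys T) (hS : Continuous S)
    (hmin : IsMinimalSys S) {J : Set (X × Y)} (hJ : IsJoining T S J)
    {C : TopologicalSpace.NonemptyCompacts X} (hC : IsDistalPoint (hyperMap T hT) C)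
    {V : Set Y} (hV : IsOpen V) (nV : V.Nonempty) : (J ∩ (C : Set X) ×ˢ V).Nonempty := by
  obtain ⟨c, hc⟩ := C.nonempty
  have : Nonempty X := ⟨c⟩
  choose d hd using fun n => hTs.iterate n c
  obtain ⟨g, hg⟩ := hTwm.exists_forall_proximal hT d
  obtain ⟨⟨_, y⟩, hgy, rfl⟩ : g ∈ Prod.fst '' J := hJ.2.2.2.1 ▸ mem_univ g
  obtain ⟨_, hyV, n, rfl⟩ := (hmin y).inter_open_nonempty V hV nV
  have hprox := (hg n).iterate hT n
  rw [hd] at hprox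
  obtain ⟨p, hp, hpy, hpc⟩ := hprox.exists_idempotent hT hS hmin (S^[n] y)
  have hmem := hJ.orbitLim_mem (hJ.iterate_mem hgy n) p
  have hpC := orbitLim_mem_orbitLim_hyperMap hT p hc
  rw [hC.orbitLim_eq_self (continuous_hyperMap hT) hp, ← hpc] at hpC
  refine ⟨_, hmem, hpC, ?_⟩
  rw [hpy]
  exact hyV

theorem stmt_8 {X : Type} [MetricSpace X] [CompactSpace X] (T : X → X)
    (hTc : Continuous T) (hTs : Function.Surjective T) (hTwm : IsWeaklyMixingSys T)
    (hdds : ∀ U : Set X, IsOpen U → U.Nonempty →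
      ∃ C : TopologicalSpace.NonemptyCompacts X,
        (C : Set X) ⊆ U ∧ IsDistalPoint (hyperMap T hTc) C) :
    ∀ 𝒴 : TDS, IsMinimalSys 𝒴.map → DisjointSys T 𝒴.map := by
  intro 𝒴 hmin J hJ
  rw [eq_univ_iff_forall]
  rintro ⟨x, y⟩
  by_contra hxy
  obtain ⟨U, V, hU, hV, hxU, hyV, hUV⟩ :=
    isOpen_prod_iff.1 hJ.2.1.isOpen_compl x y hxy
  obtain ⟨C, hCU, hC⟩ := hdds U hU ⟨x, hxU⟩
  obtain ⟨q, hqJ, hqC, hqV⟩ := hJ.inter_prod_nonempty_of_isDistalPoint hTc hTs hTwm 𝒴.cont hmin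
    hC hV ⟨y, hyV⟩
  exact hUV ⟨hCU hqC, hqV⟩ hqJ
end

section
/- Let (X,T) be a weakly mixing topological dynamical system such that for every minimal t.d.s. (Y,S) and every nonempty open set U ⊆ X there is a nonempty closed T-invariant set M ⊆ X with (M, T|_M) minimal, (M, T|_M) disjoint from (Y,S), and U ∩ M ≠ ∅. Then (X,T) is disjoint from every minimal topological dynamical system. -/
open Set Function Filter Topology

theorem IsMinimalSys.eq_univ_of_isClosed {Y : Type*} [TopologicalSpace Y] {S : Y → Y}
    (hS : IsMinimalSys S) {A : Set Y} (hA : IsClosed A) (hne : A.Nonempty)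
    (hinv : Set.MapsTo S A A) : A = Set.univ := by
  obtain ⟨a, ha⟩ := hne
  refine Set.eq_univ_of_univ_subset ((hS a).closure_eq ▸ closure_minimal ?_ hA)
  rintro _ ⟨n, rfl⟩
  exact hinv.iterate n ha

/-- A joining of `X` with a minimal system restricts to a joining over each nonempty closed
invariant subset of `X`. -/
theorem IsJoining.restrict {X Y : Type*} [TopologicalSpace X] [CompactSpace X]
    [TopologicalSpace Y] [CompactSpace Y] [T2Space Y] {T : X → X} {S : Y → Y}
    (hS : IsMinimalSys S) {J : Set (X × Y)} (hJ : IsJoining T S J) {M : Set X}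
    (hM : Set.MapsTo T M M) (hne : M.Nonempty) (hMc : IsClosed M) :
    IsJoining (Set.MapsTo.restrict T M M hM) S {p : M × Y | ((p.1 : X), p.2) ∈ J} := by
  obtain ⟨-, hJc, hJinv, hfst, -⟩ := hJ
  have : CompactSpace M := isCompact_iff_compactSpace.mp hMc.isCompact
  have lift : ∀ m : M, ∃ y, ((m : X), y) ∈ J := fun m => by
    obtain ⟨⟨x, y⟩, hp, rfl : x = m⟩ := hfst.symm ▸ Set.mem_univ (m : X)
    exact ⟨y, hp⟩
  have closed : IsClosed {p : M × Y | ((p.1 : X), p.2) ∈ J} :=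
    hJc.preimage (by fun_prop : Continuous fun p : M × Y => ((p.1 : X), p.2))
  have nonempty : {p : M × Y | ((p.1 : X), p.2) ∈ J}.Nonempty := by
    obtain ⟨m, hm⟩ := hne
    obtain ⟨y, hy⟩ := lift ⟨m, hm⟩
    exact ⟨(⟨m, hm⟩, y), hy⟩
  refine ⟨nonempty, closed, fun p hp => hJinv _ hp, ?_, ?_⟩
  · refine Set.eq_univ_of_forall fun m => ?_
    obtain ⟨y, hy⟩ := lift m
    exact ⟨(m, y), hy, rfl⟩
  · refine hS.eq_univ_of_isClosed (closed.isCompact.image continuous_snd).isClosed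
      (nonempty.image _) ?_
    rintro _ ⟨p, hp, rfl⟩
    exact ⟨(hM.restrict T M M p.1, S p.2), hJinv _ hp, rfl⟩

theorem stmt_11 {X : Type} [MetricSpace X] [CompactSpace X] (T : X → X)
    (hTc : Continuous T) (hTs : Function.Surjective T) (hTwm : IsWeaklyMixingSys T)
    (h : ∀ 𝒴 : TDS, IsMinimalSys 𝒴.map →
      ∀ U : Set X, IsOpen U → U.Nonempty →
        ∃ (M : Set X) (hM : Set.MapsTo T M M), M.Nonempty ∧ IsClosed M ∧
          IsMinimalSys (Set.MapsTo.restrict T M M hM) ∧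
          DisjointSys (Set.MapsTo.restrict T M M hM) 𝒴.map ∧
          (U ∩ M).Nonempty) :
    ∀ 𝒴 : TDS, IsMinimalSys 𝒴.map → DisjointSys T 𝒴.map := by
  intro 𝒴 h𝒴 J hJ
  refine Set.eq_univ_of_forall fun ⟨x, y⟩ => ?_
  have fiber_closed : IsClosed {x : X | (x, y) ∈ J} :=
    hJ.2.1.preimage (by fun_prop : Continuous fun x : X => (x, y))
  have fiber_dense : Dense {x : X | (x, y) ∈ J} := by
    rw [dense_iff_inter_open]
    intro U hU hUne
    obtain ⟨M, hM, hne, hMc, -, hdisj, m, hmU, hmM⟩ := h 𝒴 h𝒴 U hU hUne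
    have hall := hdisj _ (hJ.restrict h𝒴 hM hne hMc)
    have hmem : ((⟨m, hmM⟩, y) : M × 𝒴.carrier) ∈
        {p : M × 𝒴.carrier | ((p.1 : X), p.2) ∈ J} := hall ▸ Set.mem_univ _
    exact ⟨m, hmU, hmem⟩
  have hx : x ∈ closure {x : X | (x, y) ∈ J} := fiber_dense x
  rwa [fiber_closed.closure_eq] at hx
end

section
/- Let (X,T) be a weakly mixing topological dynamical system such that for every nonempty open set U ⊆ X there is a point x ∈ U with N_T(x,U) a C*-set. Then (X,T) is disjoint from every minimal topological dynamical system. -/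
open Set Function Filter Topology

/-- In a compact space every nonempty closed forward invariant set contains a minimal one. -/
theorem exists_minimal_closed_invariant {K : Type*} [TopologicalSpace K] [CompactSpace K]
    (F : K → K) {C : Set K} (hC : IsClosed C) (hne : C.Nonempty) (hinv : MapsTo F C C) :
    ∃ M ⊆ C, IsClosed M ∧ M.Nonempty ∧ MapsTo F M M ∧
      ∀ N ⊆ M, IsClosed N → N.Nonempty → MapsTo F N N → N = M := by
  obtain ⟨M, hMC, hM⟩ := zorn_superset_nonempty
    {N : Set K | IsClosed N ∧ N.Nonempty ∧ MapsTo F N N} (by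
      intro c hc hchain hcne
      refine ⟨⋂₀ c, ⟨isClosed_sInter fun N hN => (hc hN).1, ?_, ?_⟩,
        fun N hN => sInter_subset_of_mem hN⟩
      · have := hcne.to_subtype
        exact IsCompact.nonempty_sInter_of_directed_nonempty_isCompact_isClosed
          (IsChain.directedOn hchain.symm) (fun N hN => (hc hN).2.1)
          (fun N hN => (hc hN).1.isCompact) (fun N hN => (hc hN).1)
      · exact fun x hx N hN => (hc hN).2.2 (hx N hN)) C ⟨hC, hne, hinv⟩
  exact ⟨M, hMC, hM.prop.1, hM.prop.2.1, hM.prop.2.2, fun N hNM h1 h2 h3 =>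
    hNM.antisymm (hM.le_of_le ⟨h1, h2, h3⟩ hNM)⟩

theorem IsMinimalSys.eq_univ {Y : Type*} [TopologicalSpace Y] {S : Y → Y} (hS : IsMinimalSys S)
    {C : Set Y} (hC : IsClosed C) (hne : C.Nonempty) (hinv : MapsTo S C C) : C = univ := by
  obtain ⟨y, hy⟩ := hne
  refine eq_univ_of_univ_subset ?_
  rw [← (hS y).closure_eq]
  refine closure_minimal ?_ hC
  rintro _ ⟨n, rfl⟩
  exact hinv.iterate n hy

/-- A point whose orbit closure meets a closed invariant set `D` is proximal to a minimal point
of `D`, which can be chosen in the same fibre over a given minimal factor. -/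
theorem exists_isMinimalPoint_proximal {Z Y : Type*} [MetricSpace Z] [CompactSpace Z]
    [TopologicalSpace Y] [T2Space Y] {R : Z → Z} (hR : Continuous R) {S : Y → Y}
    (hS : IsMinimalSys S) {π : Z → Y} (hπ : Continuous π) (hπR : ∀ v, π (R v) = S (π v))
    {D : Set Z} (hD : IsClosed D) (hDR : MapsTo R D D) {z : Z}
    (hz : (closure (orbit R z) ∩ D).Nonempty) :
    ∃ w ∈ D, π w = π z ∧ IsMinimalPoint R w ∧ Proximal R z w := by
  let : Semigroup (Z → Z) := { mul := fun f g => f ∘ g, mul_assoc := fun _ _ _ => rfl }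
  have mul_def : ∀ f g : Z → Z, f * g = f ∘ g := fun _ _ => rfl
  have cont_right : ∀ g : Z → Z, Continuous fun f : Z → Z => f ∘ g := fun g =>
    continuous_pi fun v => continuous_apply (g v)
  have cont_R : Continuous fun f : Z → Z => R ∘ f :=
    continuous_pi fun v => hR.comp (continuous_apply v)
  have hπiter : ∀ n v, π (R^[n] v) = S^[n] (π v) := by
    intro n v
    exact (Function.Semiconj.iterate_right (f := π) hπR n) v
  set E : Set (Z → Z) := closure (range fun n : ℕ => R^[n]) with hE
  have E_ind : ∀ Q : Set (Z → Z), IsClosed Q → (∀ n, R^[n] ∈ Q) → E ⊆ Q := by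
    intro Q hQ h
    exact closure_minimal (range_subset_iff.2 h) hQ
  have E_R : MapsTo (fun f => R ∘ f) E E := by
    refine MapsTo.closure ?_ cont_R
    rintro _ ⟨n, rfl⟩
    exact ⟨n + 1, Function.iterate_succ' R n⟩
  have E_act : ∀ Q : Set (Z → Z), IsClosed Q → MapsTo (fun f => R ∘ f) Q Q →
      ∀ f ∈ E, ∀ g ∈ Q, f ∘ g ∈ Q := by
    intro Q hQ h f hf g hg
    refine E_ind ((fun f => f ∘ g) ⁻¹' Q) (hQ.preimage (cont_right g)) (fun n => ?_) hf
    induction n with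
    | zero => exact hg
    | succ n ih =>
      rw [Function.iterate_succ']
      exact h ih
  have E_orbit : closure (orbit R z) ⊆ (fun f => f z) '' E := by
    refine closure_minimal ?_ (isClosed_closure.isCompact.image (continuous_apply z)).isClosed
    rintro _ ⟨n, rfl⟩
    exact ⟨R^[n], subset_closure ⟨n, rfl⟩, rfl⟩
  obtain ⟨v, hv, hvD⟩ := hz
  obtain ⟨f₀, hf₀, rfl⟩ := E_orbit hv
  obtain ⟨L, hLI, hLc, hLne, hLR, hLmin⟩ := exists_minimal_closed_invariant (fun f => R ∘ f)
    (C := E ∩ {f | f z ∈ D}) (isClosed_closure.inter (hD.preimage (continuous_apply z)))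
    ⟨f₀, hf₀, hvD⟩ (fun f hf => ⟨E_R hf.1, hDR hf.2⟩)
  have L_min : ∀ f ∈ L, L ⊆ closure (range fun n : ℕ => R^[n] ∘ f) := by
    intro f hf
    refine (hLmin _ (closure_minimal ?_ hLc) isClosed_closure
      ⟨f, subset_closure (mem_range.2 ⟨0, rfl⟩)⟩ ?_).ge
    · rintro _ ⟨n, rfl⟩
      exact E_act L hLc hLR _ (subset_closure ⟨n, rfl⟩) f hf
    · refine MapsTo.closure ?_ cont_R
      rintro _ ⟨n, rfl⟩
      exact ⟨n + 1, by simp only [Function.iterate_succ']; rfl⟩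
  have L_point : ∀ f ∈ L, IsMinimalPoint R (f z) := by
    intro f hf v hv
    have hv' : v ∈ (fun f => f z) '' L := by
      refine closure_minimal ?_ (hLc.isCompact.image (continuous_apply z)).isClosed hv
      rintro _ ⟨n, rfl⟩
      exact ⟨R^[n] ∘ f, E_act L hLc hLR _ (subset_closure ⟨n, rfl⟩) f hf, rfl⟩
    obtain ⟨g, hg, rfl⟩ := hv'
    have hfg : f z ∈ closure (orbit R (g z)) := by
      have : MapsTo (fun f : Z → Z => f z) (closure (range fun n : ℕ => R^[n] ∘ g))
          (closure (orbit R (g z))) := by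
        refine MapsTo.closure ?_ (continuous_apply z)
        rintro _ ⟨n, rfl⟩
        exact ⟨n, rfl⟩
      exact this (L_min g hg hf)
    refine closure_minimal ?_ isClosed_closure
    rintro _ ⟨n, rfl⟩
    have : MapsTo R (closure (orbit R (g z))) (closure (orbit R (g z))) := by
      refine MapsTo.closure ?_ hR
      rintro _ ⟨m, rfl⟩
      exact ⟨m + 1, Function.iterate_succ_apply' R m _⟩
    exact this.iterate n hfg
  have hLY : (fun f : Z → Z => π (f z)) '' L = univ := by
    refine hS.eq_univ (hLc.isCompact.image (hπ.comp (continuous_apply z))).isClosed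
      (hLne.image _) ?_
    rintro _ ⟨f, hf, rfl⟩
    exact ⟨R ∘ f, hLR hf, hπR _⟩
  have E_fibre : ∀ f ∈ E, ∀ v v', π v = π v' → π (f v) = π (f v') := by
    intro f hf v v' h
    refine E_ind {f | π (f v) = π (f v')} (isClosed_eq (hπ.comp (continuous_apply v))
      (hπ.comp (continuous_apply v'))) (fun n => ?_) hf
    simp only [mem_ofPred_eq, hπiter, h]
  obtain ⟨f₁, hf₁, hf₁z⟩ := hLY.ge (mem_univ (π z))
  obtain ⟨u, ⟨huL, huz⟩, huu⟩ := exists_idempotent_in_compact_subsemigroup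
    (M := Z → Z) cont_right (L ∩ {f | π (f z) = π z}) ⟨f₁, hf₁, hf₁z⟩
    (hLc.inter (isClosed_eq (hπ.comp (continuous_apply z)) continuous_const)).isCompact (by
      rintro f ⟨hf, hfz⟩ g ⟨hg, hgz⟩
      exact ⟨E_act L hLc hLR f (hLI hf).1 g hg,
        (E_fibre f (hLI hf).1 _ _ hgz).trans hfz⟩)
  refine ⟨u z, (hLI huL).2, huz, L_point u huL, ?_⟩
  have huu' : u (u z) = u z := congrFun huu z
  have key : ∀ m : ℕ, ∃ n : ℕ, dist (R^[n] z) (R^[n] (u z)) < 1 / ((m : ℝ) + 1) := by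
    intro m
    have ho : IsOpen {f : Z → Z | dist (f z) (f (u z)) < 1 / ((m : ℝ) + 1)} :=
      isOpen_lt ((continuous_apply z).dist (continuous_apply (u z))) continuous_const
    obtain ⟨_, hn, n, rfl⟩ := mem_closure_iff.1 (hLI huL).1 _ ho (by
      simp only [mem_ofPred_eq, huu', dist_self]
      positivity)
    exact ⟨n, hn⟩
  choose n hn using key
  exact ⟨n, squeeze_zero (fun _ => dist_nonneg) (fun m => (hn m).le)
    tendsto_one_div_add_atTop_nhds_zero_nat⟩

/-- The return-time sets of a weakly mixing system form a filter base. -/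
theorem IsWeaklyMixingSys.exists_subset_inter {X : Type*} [TopologicalSpace X] {T : X → X}
    (hTc : Continuous T) (hT : IsWeaklyMixingSys T) {U₁ V₁ U₂ V₂ : Set X}
    (hU₁ : IsOpen U₁) (hV₁ : IsOpen V₁) (hU₂ : IsOpen U₂) (hV₂ : IsOpen V₂)
    (nU₁ : U₁.Nonempty) (nV₁ : V₁.Nonempty) (nU₂ : U₂.Nonempty) (nV₂ : V₂.Nonempty) :
    ∃ U V : Set X, IsOpen U ∧ IsOpen V ∧ U.Nonempty ∧ V.Nonempty ∧
      ∀ n, (U ∩ T^[n] ⁻¹' V).Nonempty →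
        (U₁ ∩ T^[n] ⁻¹' V₁).Nonempty ∧ (U₂ ∩ T^[n] ⁻¹' V₂).Nonempty := by
  have iter : ∀ n (p : X × X), (fun p : X × X => (T p.1, T p.2))^[n] p
      = (T^[n] p.1, T^[n] p.2) := fun n p => congrFun (Prod.map_iterate T T n) p
  obtain ⟨m, p, hp, hpm⟩ := (hT _ _ (hU₁.prod hV₁) (hU₂.prod hV₂)
    (nU₁.prod nV₁) (nU₂.prod nV₂)).nonempty
  rw [mem_preimage, iter] at hpm
  refine ⟨U₁ ∩ T^[m] ⁻¹' U₂, V₁ ∩ T^[m] ⁻¹' V₂, hU₁.inter (hU₂.preimage (hTc.iterate m)),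
    hV₁.inter (hV₂.preimage (hTc.iterate m)), ⟨p.1, hp.1, hpm.1⟩, ⟨p.2, hp.2, hpm.2⟩, ?_⟩
  rintro n ⟨x, ⟨hx1, hx2⟩, hx3, hx4⟩
  refine ⟨⟨x, hx1, hx3⟩, T^[m] x, hx2, ?_⟩
  rw [mem_preimage, ← Function.iterate_add_apply, add_comm, Function.iterate_add_apply]
  exact hx4

theorem IsWeaklyMixingSys.isTransitiveSys {X : Type*} [TopologicalSpace X] {T : X → X}
    (hT : IsWeaklyMixingSys T) : IsTransitiveSys T := by
  intro U V hU hV nU nV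
  refine (hT _ _ (hU.prod hU) (hV.prod hV) (nU.prod nU) (nV.prod nV)).mono ?_
  rintro n ⟨p, hp, hpn⟩
  rw [mem_preimage, show (fun p : X × X => (T p.1, T p.2))^[n] p
      = (T^[n] p.1, T^[n] p.2) from congrFun (Prod.map_iterate T T n) p] at hpn
  exact ⟨p.1, hp.1, hpn.1⟩

theorem IsWeaklyMixingSys.infinite_forall {X ι : Type*} [TopologicalSpace X] {T : X → X}
    (hTc : Continuous T) (hT : IsWeaklyMixingSys T) {U : Set X} (hU : IsOpen U)
    (nU : U.Nonempty) (s : Finset ι) (W : ι → Set X) (hW : ∀ i ∈ s, IsOpen (W i))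
    (nW : ∀ i ∈ s, (W i).Nonempty) :
    {n : ℕ | ∀ i ∈ s, (U ∩ T^[n] ⁻¹' W i).Nonempty}.Infinite := by
  classical
  have : ∃ A B : Set X, IsOpen A ∧ IsOpen B ∧ A.Nonempty ∧ B.Nonempty ∧
      ∀ n, (A ∩ T^[n] ⁻¹' B).Nonempty → ∀ i ∈ s, (U ∩ T^[n] ⁻¹' W i).Nonempty := by
    induction s using Finset.induction_on with
    | empty => exact ⟨U, U, hU, hU, nU, nU, by simp⟩
    | insert a s _ ih =>
      obtain ⟨A, B, hA, hB, nA, nB, hAB⟩ := ih (fun i hi => hW i (Finset.mem_insert_of_mem hi))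
        (fun i hi => nW i (Finset.mem_insert_of_mem hi))
      obtain ⟨A', B', hA', hB', nA', nB', h'⟩ := hT.exists_subset_inter hTc hA hB hU
        (hW a (Finset.mem_insert_self a s)) nA nB nU (nW a (Finset.mem_insert_self a s))
      refine ⟨A', B', hA', hB', nA', nB', fun n hn i hi => ?_⟩
      rcases Finset.mem_insert.1 hi with rfl | hi
      · exact (h' n hn).2
      · exact hAB n (h' n hn).1 i hi
  obtain ⟨A, B, hA, hB, nA, nB, hAB⟩ := this
  exact (hT.isTransitiveSys A B hA hB nA nB).mono hAB

/-- In a weakly mixing system, for every point `x` some point has its whole orbit proximal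
to `x`. -/
theorem IsWeaklyMixingSys.exists_forall_iterate_proximal {X : Type*} [MetricSpace X]
    [CompactSpace X] {T : X → X} (hTc : Continuous T) (hT : IsWeaklyMixingSys T) (x : X) :
    ∃ x₀ : X, ∀ k : ℕ, ∀ ε > 0, ∃ n : ℕ, dist (T^[n] (T^[k] x₀)) (T^[n] x) < ε := by
  let G : ℕ × ℕ → Set X := fun q =>
    ⋃ n : ℕ, {a | dist (T^[n] (T^[q.1] a)) (T^[n] x) < 1 / ((q.2 : ℝ) + 1)}
  have hGo : ∀ q, IsOpen (G q) := fun q => isOpen_iUnion fun n =>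
    isOpen_lt ((((hTc.iterate n).comp (hTc.iterate q.1))).dist continuous_const) continuous_const
  have hGd : ∀ q, Dense (G q) := by
    rintro ⟨k, m⟩
    rw [dense_iff_inter_open]
    intro U hU nU
    have hε : (0 : ℝ) < 1 / ((m : ℝ) + 1) / 2 := by positivity
    obtain ⟨t, -, ht, htU⟩ := finite_cover_balls_of_compact (isCompact_univ (X := X)) hε
    obtain ⟨N, hN, hkN⟩ := (hT.infinite_forall hTc hU nU ht.toFinset
      (fun c => Metric.ball c (1 / ((m : ℝ) + 1) / 2)) (fun _ _ => Metric.isOpen_ball)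
      (fun c _ => ⟨c, Metric.mem_ball_self hε⟩)).exists_gt k
    obtain ⟨c, hc, hxc⟩ := mem_iUnion₂.1 (htU (mem_univ (T^[N - k] x)))
    obtain ⟨a, haU, hac⟩ := hN c (ht.mem_toFinset.2 hc)
    refine ⟨a, haU, mem_iUnion.2 ⟨N - k, ?_⟩⟩
    rw [mem_ofPred_eq, ← Function.iterate_add_apply, Nat.sub_add_cancel hkN.le]
    have h1 : dist (T^[N] a) c < 1 / ((m : ℝ) + 1) / 2 := hac
    have h2 : dist (T^[N - k] x) c < 1 / ((m : ℝ) + 1) / 2 := hxc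
    have := dist_triangle_right (T^[N] a) (T^[N - k] x) c
    dsimp only
    linarith
  have : Nonempty X := ⟨x⟩
  obtain ⟨x₀, hx₀⟩ := (dense_iInter_of_isOpen hGo hGd).nonempty
  refine ⟨x₀, fun k ε hε => ?_⟩
  obtain ⟨m, hm⟩ := exists_nat_one_div_lt hε
  obtain ⟨n, hn⟩ := mem_iUnion.1 (mem_iInter.1 hx₀ (k, m))
  exact ⟨n, lt_trans hn hm⟩

/-- A C*-set meets the set of times at which a point of a minimal system returns to a neighbourhood
while two given proximal points are close to each other. -/
theorem CStarSet.exists_proximal_return {A : Set ℕ} (hA : CStarSet A) {X : Type} [MetricSpace X]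
    [CompactSpace X] {T : X → X} (hTc : Continuous T) (hTs : Function.Surjective T) {x x' : X}
    (hxx' : ∀ ε > 0, ∃ n : ℕ, dist (T^[n] x) (T^[n] x') < ε)
    {Y : TDS} (hY : IsMinimalSys Y.map) {y : Y.carrier} {V : Set Y.carrier} (hV : IsOpen V)
    (hy : y ∈ V) {ε : ℝ} (hε : 0 < ε) :
    ∃ n ∈ A, dist (T^[n] x) (T^[n] x') < ε ∧ Y.map^[n] y ∈ V := by
  let R : (X × X) × Y.carrier → (X × X) × Y.carrier := Prod.map (Prod.map T T) Y.map
  have hR : Continuous R := (hTc.prodMap hTc).prodMap Y.cont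
  have iter : ∀ n p, R^[n] p = ((T^[n] p.1.1, T^[n] p.1.2), Y.map^[n] p.2) := by
    intro n p
    simp only [R, Prod.map_iterate, Prod.map]
  have hD : IsClosed {p : (X × X) × Y.carrier | p.1.1 = p.1.2} :=
    isClosed_eq (by fun_prop) (by fun_prop)
  have hmeet : (closure (orbit R ((x, x'), y)) ∩
      {p : (X × X) × Y.carrier | p.1.1 = p.1.2}).Nonempty := by
    have hne : (closure (orbit R ((x, x'), y))).Nonempty := ⟨_, subset_closure ⟨0, rfl⟩⟩
    obtain ⟨p, hp, hmin⟩ := (isClosed_closure (s := orbit R ((x, x'), y))).isCompact.exists_isMinOn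
      hne (f := fun p => dist p.1.1 p.1.2) (by fun_prop)
    refine ⟨p, hp, ?_⟩
    by_contra hne'
    obtain ⟨n, hn⟩ := hxx' _ (dist_pos.2 hne')
    have := hmin (subset_closure ⟨n, rfl⟩)
    simp only [iter, mem_ofPred_eq] at this
    exact absurd hn (not_lt.2 this)
  obtain ⟨w, hwD, hwy, hwmin, hwprox⟩ := exists_isMinimalPoint_proximal hR hY
    (π := Prod.snd) continuous_snd (fun _ => rfl) hD
    (fun p (hp : p.1.1 = p.1.2) => congrArg T hp) hmeet
  obtain ⟨n, hnA, hn⟩ := hA {n | R^[n] ((x, x'), y) ∈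
      {p : (X × X) × Y.carrier | dist p.1.1 p.1.2 < ε} ∩ Prod.snd ⁻¹' V}
    ⟨{ carrier := (X × X) × Y.carrier
       map := R
       cont := hR
       surj := (hTs.prodMap hTs).prodMap Y.surj }, ((x, x'), y), w, _, hwmin, hwprox,
      (isOpen_lt (by fun_prop) (by fun_prop)).inter (hV.preimage continuous_snd), by
        refine ⟨?_, ?_⟩
        · rw [mem_ofPred_eq, show w.1.1 = w.1.2 from hwD, dist_self]
          exact hε
        · rw [mem_preimage, hwy]
          exact hy, fun _ h => h⟩
  rw [mem_ofPred_eq, iter] at hn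
  exact ⟨n, hnA, hn.1, hn.2⟩

theorem stmt_12 {X : Type} [MetricSpace X] [CompactSpace X] (T : X → X)
    (hTc : Continuous T) (hTs : Function.Surjective T) (hTwm : IsWeaklyMixingSys T)
    (h : ∀ U : Set X, IsOpen U → U.Nonempty →
      ∃ x ∈ U, CStarSet {n : ℕ | T^[n] x ∈ U}) :
    ∀ 𝒴 : TDS, IsMinimalSys 𝒴.map → DisjointSys T 𝒴.map := by
  intro 𝒴 hY J ⟨_, hJc, hJinv, hJ₁, _⟩
  have hJiter : ∀ (n : ℕ) (p : X × 𝒴.carrier), p ∈ J → (T^[n] p.1, 𝒴.map^[n] p.2) ∈ J := by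
    intro n p hp
    induction n with
    | zero => exact hp
    | succ n ih =>
      rw [Function.iterate_succ_apply', Function.iterate_succ_apply']
      exact hJinv _ ih
  refine eq_univ_of_forall fun ⟨a, b⟩ => ?_
  rw [← hJc.closure_eq, mem_closure_iff_nhds_basis (Metric.nhds_basis_ball)]
  intro r hr
  obtain ⟨x, hx, hxC⟩ := h (Metric.ball a (r / 2)) Metric.isOpen_ball
    ⟨a, Metric.mem_ball_self (half_pos hr)⟩
  obtain ⟨x₀, hx₀⟩ := hTwm.exists_forall_iterate_proximal hTc x
  obtain ⟨⟨x₁, y₀⟩, hp, hx₁⟩ := hJ₁.ge (mem_univ x₀)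
  obtain rfl : x₁ = x₀ := hx₁
  obtain ⟨_, hk, k, rfl⟩ := (hY y₀).inter_open_nonempty _ (Metric.isOpen_ball (x := b) (ε := r))
    ⟨b, Metric.mem_ball_self hr⟩
  obtain ⟨n, hn, hnx, hny⟩ := hxC.exists_proximal_return hTc hTs (hx₀ k) hY
    Metric.isOpen_ball hk (half_pos hr)
  refine ⟨_, hJiter n _ (hJiter k _ hp), ?_⟩
  rw [← ball_prod_same]
  refine ⟨?_, hny⟩
  have h1 : dist (T^[n] x) a < r / 2 := hn
  have h2 := dist_triangle (T^[n] (T^[k] x₁)) (T^[n] x) a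
  rw [Metric.mem_ball]
  linarith
end
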